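/- Fix a real number p ≥ 2 and a natural number m ≥ 2. Let u : ℝ^a → ℝ^n be an affine map u(x) = u₀ + A x with A ∘ A* = λ² id_{ℝ^n} for a constant λ ≥ 0. If f : ℝ^n → ℝ^ℓ is a p-m-symphonic map, i.e. div(‖d_m f‖^{p−2} σ_{m,f}) ≡ 0, then the composition f ∘ u is also p-m-symphonic: div(‖d_m(f∘u)‖^{p−2} σ_{m,f∘u}) ≡ 0. -/

import Mathlib

noncomputable section

open ContinuousLinearMap

/-- Euclidean space ℝ^n. -/
abbrev Euc (n : ℕ) : Type := EuclideanSpace ℝ (Fin n)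

/-- The `m`-th stress field `σ_{m,v}(x) = (Dv(x) ∘ Dv(x)*)^{m−1} ∘ Dv(x)`. -/
def mstress {a : ℕ} {F : Type*} [NormedAddCommGroup F] [InnerProductSpace ℝ F]
    [CompleteSpace F] (m : ℕ) (v : Euc a → F) (x : Euc a) : Euc a →L[ℝ] F :=
  (((fderiv ℝ v x) ∘L (ContinuousLinearMap.adjoint (fderiv ℝ v x))) ^ (m - 1)) ∘L
    (fderiv ℝ v x)

/-- Divergence of a field of linear maps: `div τ(x) = Σ_β D(y ↦ τ(y)(e_β))(x)(e_β)`. -/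
def divF {a : ℕ} {F : Type*} [NormedAddCommGroup F] [NormedSpace ℝ F]
    (τ : Euc a → (Euc a →L[ℝ] F)) (x : Euc a) : F :=
  ∑ β : Fin a, fderiv ℝ (fun y => τ y (EuclideanSpace.single β (1 : ℝ))) x
    (EuclideanSpace.single β (1 : ℝ))

/-- `‖d_m v‖²(x) = trace((Dv(x)* ∘ Dv(x))^m)`. -/
def dmNormSq {a : ℕ} {F : Type*} [NormedAddCommGroup F] [InnerProductSpace ℝ F]
    [CompleteSpace F] (m : ℕ) (v : Euc a → F) (x : Euc a) : ℝ :=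
  LinearMap.trace ℝ (Euc a)
    ((((ContinuousLinearMap.adjoint (fderiv ℝ v x)) ∘L (fderiv ℝ v x)) ^ m :
      Euc a →L[ℝ] Euc a) : Euc a →ₗ[ℝ] Euc a)

/-- The weighted `m`-th stress field `x ↦ ‖d_m v‖^{p−2}(x) σ_{m,v}(x)` (real exponent). -/
def wmStress {a : ℕ} {F : Type*} [NormedAddCommGroup F] [InnerProductSpace ℝ F]
    [CompleteSpace F] (p : ℝ) (m : ℕ) (v : Euc a → F) (x : Euc a) : Euc a →L[ℝ] F :=
  (Real.sqrt (dmNormSq m v x) ^ (p - 2)) • mstress m v x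

/-- A smooth map `v` is `p`-`m`-symphonic if `div(‖d_m v‖^{p−2} σ_{m,v}) ≡ 0`. -/
def IsPMSymphonic {a : ℕ} {F : Type*} [NormedAddCommGroup F] [InnerProductSpace ℝ F]
    [CompleteSpace F] (p : ℝ) (m : ℕ) (v : Euc a → F) : Prop :=
  ∀ x, divF (wmStress p m v) x = 0

section Trace

variable {E F : Type*} [NormedAddCommGroup E] [InnerProductSpace ℝ E] [CompleteSpace E]
  [NormedAddCommGroup F] [InnerProductSpace ℝ F] [CompleteSpace F]

lemma inner_adjoint_comp_self_pow_nonneg (D : E →L[ℝ] F) (m : ℕ) (v : E) :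
    0 ≤ inner ℝ v (((adjoint D ∘L D) ^ m) v) ∧
      (inner ℝ v (((adjoint D ∘L D) ^ m) v) = 0 → ((adjoint D ∘L D) ^ (m + 1)) v = 0) := by
  set S := adjoint D ∘L D with hS
  have hSapp : ∀ x, S x = adjoint D (D x) := fun x => rfl
  have hsa : IsSelfAdjoint S := (isPositive_adjoint_comp_self D).isSelfAdjoint
  have key : ∀ k x y, inner ℝ x ((S ^ k) y) = inner ℝ ((S ^ k) x) y := by
    intro k x y
    have h : adjoint (S ^ k) = S ^ k := (hsa.pow k).adjoint_eq
    rw [← adjoint_inner_left, h]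
  rcases Nat.even_or_odd' m with ⟨k, rfl | rfl⟩
  · have h1 : inner ℝ v ((S ^ (2 * k)) v) = ‖(S ^ k) v‖ ^ 2 := by
      rw [two_mul, pow_add, mul_apply_eq_comp, key, real_inner_self_eq_norm_sq]
    rw [h1]
    refine ⟨sq_nonneg _, fun h => ?_⟩
    have h0 : (S ^ k) v = 0 := by simpa using h
    rw [show 2 * k + 1 = (k + 1) + k by ring, pow_add, mul_apply_eq_comp, h0, map_zero]
  · have h1 : inner ℝ v ((S ^ (2 * k + 1)) v) = ‖D ((S ^ k) v)‖ ^ 2 := by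
      rw [show 2 * k + 1 = k + (1 + k) by ring, pow_add, mul_apply_eq_comp, key, pow_add,
        mul_apply_eq_comp, pow_one, hSapp, adjoint_inner_right, real_inner_self_eq_norm_sq]
    rw [h1]
    refine ⟨sq_nonneg _, fun h => ?_⟩
    have h0 : D ((S ^ k) v) = 0 := by simpa using h
    rw [show 2 * k + 1 + 1 = (k + 1) + (1 + k) by ring, pow_add, mul_apply_eq_comp, pow_add S 1 k,
      mul_apply_eq_comp, pow_one, hSapp, h0, map_zero, map_zero]

lemma eq_zero_of_adjoint_comp_self_pow_eq_zero (D : E →L[ℝ] F) (N : ℕ)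
    (h : (adjoint D ∘L D) ^ N = 0) : D = 0 := by
  have hsa : IsSelfAdjoint (adjoint D ∘L D : E →L[ℝ] E) :=
    (isPositive_adjoint_comp_self D).isSelfAdjoint
  have h2 := IsSelfAdjoint.norm_pow_two_pow (E := E →L[ℝ] E) hsa N
  rw [pow_eq_zero_of_le (Nat.lt_two_pow_self (n := N)).le h, norm_zero] at h2
  have h3 : adjoint D ∘L D = 0 := norm_eq_zero.1 (pow_eq_zero_iff (by positivity) |>.1 h2.symm)
  exact adjoint_comp_self_eq_zero_iff.1 h3

lemma eq_zero_of_trace_adjoint_comp_self_pow_eq_zero [FiniteDimensional ℝ E] (D : E →L[ℝ] F)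
    (m : ℕ) (h : LinearMap.trace ℝ E (((adjoint D ∘L D) ^ m : E →L[ℝ] E) : E →ₗ[ℝ] E) = 0) :
    D = 0 := by
  let b := stdOrthonormalBasis ℝ E
  rw [LinearMap.trace_eq_sum_inner _ b] at h
  simp only [coe_coe] at h
  rw [Finset.sum_eq_zero_iff_of_nonneg
    (fun i _ => (inner_adjoint_comp_self_pow_nonneg D m (b i)).1)] at h
  apply eq_zero_of_adjoint_comp_self_pow_eq_zero D (m + 1)
  have h' : (((adjoint D ∘L D) ^ (m + 1) : E →L[ℝ] E) : E →ₗ[ℝ] E) = 0 :=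
    b.toBasis.ext fun i => by
      rw [OrthonormalBasis.coe_toBasis]
      exact (inner_adjoint_comp_self_pow_nonneg D m (b i)).2 (h i (Finset.mem_univ i))
  exact ContinuousLinearMap.coe_injective h'

end Trace

lemma trace_comp_comm_pow {E F : Type*} [NormedAddCommGroup E] [NormedSpace ℝ E]
    [NormedAddCommGroup F] [NormedSpace ℝ F] [FiniteDimensional ℝ E] [FiniteDimensional ℝ F]
    (B : E →L[ℝ] F) (C : F →L[ℝ] E) (m : ℕ) (hm : m ≠ 0) :
    LinearMap.trace ℝ E (((C ∘L B) ^ m : E →L[ℝ] E) : E →ₗ[ℝ] E) =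
      LinearMap.trace ℝ F (((B ∘L C) ^ m : F →L[ℝ] F) : F →ₗ[ℝ] F) := by
  obtain ⟨k, rfl⟩ := Nat.exists_eq_succ_of_ne_zero hm
  have hcomm : ∀ k : ℕ, B ∘L ((C ∘L B) ^ k) = ((B ∘L C) ^ k) ∘L B := by
    intro k
    induction k with
    | zero => ext; simp
    | succ k ih =>
      rw [pow_succ, pow_succ, mul_def, mul_def, ← comp_assoc, ih]
      simp only [comp_assoc]
  have h1 : (C ∘L B) ^ (k + 1) = C ∘L (((B ∘L C) ^ k) ∘L B) := by
    rw [pow_succ', mul_def, comp_assoc, hcomm]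
  have h2 : (B ∘L C) ^ (k + 1) = (((B ∘L C) ^ k) ∘L B) ∘L C := by
    rw [pow_succ, mul_def, comp_assoc]
  rw [Nat.succ_eq_add_one, h1, h2]
  exact LinearMap.trace_comp_comm' (R := ℝ) ((((B ∘L C) ^ k) ∘L B : E →L[ℝ] F) : E →ₗ[ℝ] F)
    (C : F →ₗ[ℝ] E)

section Differentiability

variable {X E F G : Type*} [NormedAddCommGroup X] [NormedSpace ℝ X]
  [NormedAddCommGroup E] [NormedSpace ℝ E] [NormedAddCommGroup F] [NormedSpace ℝ F]
  [NormedAddCommGroup G] [NormedSpace ℝ G]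

/-- A product of a continuous operator-valued map with a differentiable one vanishing at the point
is differentiable there. -/
lemma differentiableAt_comp_of_eq_zero {g : X → F →L[ℝ] G} {D : X → E →L[ℝ] F} {x : X}
    (hg : ContinuousAt g x) (hD : DifferentiableAt ℝ D x) (h0 : D x = 0) :
    DifferentiableAt ℝ (fun y => g y ∘L D y) x := by
  have h1 : DifferentiableAt ℝ (fun y => g x ∘L D y) x :=
    (differentiableAt_const (g x)).clm_comp hD
  have h2 : HasFDerivAt (fun y => (g y - g x) ∘L D y) (0 : X →L[ℝ] E →L[ℝ] G) x := by
    refine HasFDerivAt.of_isLittleO ?_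
    simp only [h0, comp_zero, sub_zero, zero_apply]
    have hb : (fun y => (g y - g x) ∘L D y) =O[nhds x] fun y => ‖g y - g x‖ * ‖D y‖ :=
      Asymptotics.IsBigO.of_bound 1 (Filter.Eventually.of_forall fun y => by
        simpa using opNorm_comp_le (g y - g x) (D y))
    have hl : (fun y => ‖g y - g x‖) =o[nhds x] fun _ => (1 : ℝ) := by
      rw [Asymptotics.isLittleO_one_iff]
      have := (hg.sub (continuousAt_const (y := g x))).norm
      simpa [ContinuousAt] using this
    have hO : (fun y => ‖D y‖) =O[nhds x] fun y => ‖y - x‖ := by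
      have := hD.isBigO_sub
      simp only [h0, sub_zero] at this
      exact this.norm_norm
    have := hb.trans_isLittleO (hl.mul_isBigO hO)
    simp only [one_mul] at this
    exact this.of_norm_right
  have h3 := h2.differentiableAt.add h1
  refine h3.congr_of_eventuallyEq (Filter.Eventually.of_forall fun y => ?_)
  ext v
  simp

end Differentiability

section Symphonic

variable {a n ℓ : ℕ}

lemma differentiable_fderiv_of_contDiff {f : Euc n → Euc ℓ} (hf : ContDiff ℝ (⊤ : ℕ∞) f) :
    Differentiable ℝ (fderiv ℝ f) :=
  (hf.fderiv_right (m := 1) (by norm_cast)).differentiable one_ne_zero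

lemma differentiable_adjoint_fderiv {f : Euc n → Euc ℓ} (hf : ContDiff ℝ (⊤ : ℕ∞) f) :
    Differentiable ℝ (fun x => adjoint (fderiv ℝ f x)) :=
  (adjoint (𝕜 := ℝ) (E := Euc n) (F := Euc ℓ)).toContinuousLinearEquiv.toContinuousLinearMap
    |>.differentiable.comp (differentiable_fderiv_of_contDiff hf)

lemma differentiable_dmNormSq {f : Euc n → Euc ℓ} (hf : ContDiff ℝ (⊤ : ℕ∞) f) (m : ℕ) :
    Differentiable ℝ (dmNormSq m f) := by
  have hS : Differentiable ℝ
      (fun x => ((adjoint (fderiv ℝ f x)) ∘L (fderiv ℝ f x)) ^ m) :=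
    ((differentiable_adjoint_fderiv hf).clm_comp (differentiable_fderiv_of_contDiff hf)).pow m
  have hT := (LinearMap.toContinuousLinearMap
    ((LinearMap.trace ℝ (Euc n)).comp
      (ContinuousLinearMap.coeLM ℝ : (Euc n →L[ℝ] Euc n) →ₗ[ℝ] _))).differentiable.comp hS
  exact hT

lemma differentiable_wmStress {f : Euc n → Euc ℓ} (hf : ContDiff ℝ (⊤ : ℕ∞) f) {p : ℝ}
    (hp : 2 ≤ p) (m : ℕ) : Differentiable ℝ (wmStress p m f) := by
  intro x
  have hD := differentiable_fderiv_of_contDiff hf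
  have hN := differentiable_dmNormSq hf m
  have hP : Differentiable ℝ
      (fun x => ((fderiv ℝ f x) ∘L (adjoint (fderiv ℝ f x))) ^ (m - 1)) :=
    (hD.clm_comp (differentiable_adjoint_fderiv hf)).pow (m - 1)
  by_cases h0 : fderiv ℝ f x = 0
  · have hg : ContinuousAt (fun y => (Real.sqrt (dmNormSq m f y) ^ (p - 2)) •
        ((fderiv ℝ f y) ∘L (adjoint (fderiv ℝ f y))) ^ (m - 1)) x :=
      ((hN.continuous.sqrt.continuousAt).rpow_const (Or.inr (by linarith))).smul
        hP.continuous.continuousAt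
    exact differentiableAt_comp_of_eq_zero hg (hD x) h0
  · have hne : dmNormSq m f x ≠ 0 := fun h =>
      h0 (eq_zero_of_trace_adjoint_comp_self_pow_eq_zero _ m h)
    have hpos : 0 < dmNormSq m f x := by
      refine lt_of_le_of_ne ?_ hne.symm
      rw [dmNormSq, LinearMap.trace_eq_sum_inner _ (stdOrthonormalBasis ℝ (Euc n))]
      exact Finset.sum_nonneg fun i _ => (inner_adjoint_comp_self_pow_nonneg _ m _).1
    exact (((hN x).sqrt hne).rpow_const (Or.inl (Real.sqrt_pos.2 hpos).ne')).smul
      ((hP x).clm_comp (hD x))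

lemma sum_bilin_comp_of_comp_adjoint_eq_smul {F : Type*} [NormedAddCommGroup F] [NormedSpace ℝ F]
    (A : Euc a →L[ℝ] Euc n) (c : ℝ)
    (hA : A ∘L adjoint A = c • ContinuousLinearMap.id ℝ (Euc n))
    (B : Euc n →L[ℝ] Euc n →L[ℝ] F) :
    ∑ β : Fin a, B (A (EuclideanSpace.single β 1)) (A (EuclideanSpace.single β 1)) =
      c • ∑ i : Fin n, B (EuclideanSpace.single i 1) (EuclideanSpace.single i 1) := by
  have hexp : ∀ w : Euc n, w = ∑ i, w i • EuclideanSpace.single i (1 : ℝ) := fun w => by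
    have := (EuclideanSpace.basisFun (Fin n) ℝ).sum_repr w
    simpa using this.symm
  have hB : ∀ w : Euc n, B w w = ∑ i, ∑ j, (w i * w j) •
      B (EuclideanSpace.single i 1) (EuclideanSpace.single j 1) := fun w => by
    conv_lhs => rw [hexp w]
    simp only [map_sum, map_smul, sum_apply, smul_apply, Finset.smul_sum, smul_smul]
    rw [Finset.sum_comm]
    simp only [mul_comm]
  have hcoef : ∀ i j : Fin n, ∑ β : Fin a, A (EuclideanSpace.single β 1) i *
      A (EuclideanSpace.single β 1) j = if i = j then c else 0 := fun i j => by
    have h1 := congrArg (fun L : Euc n →L[ℝ] Euc n =>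
      inner ℝ (EuclideanSpace.single i (1 : ℝ)) (L (EuclideanSpace.single j 1))) hA
    simp only [comp_apply, smul_apply, id_apply] at h1
    rw [← adjoint_inner_left,
      ← (EuclideanSpace.basisFun (Fin a) ℝ).sum_inner_mul_inner] at h1
    simp only [adjoint_inner_left, adjoint_inner_right, EuclideanSpace.basisFun_apply] at h1
    simpa [EuclideanSpace.inner_single_left, EuclideanSpace.inner_single_right,
      PiLp.single_apply, eq_comm] using h1
  simp only [hB (A _)]
  rw [Finset.sum_comm]
  simp only [fun i : Fin n => Finset.sum_comm (s := (Finset.univ : Finset (Fin a)))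
    (t := (Finset.univ : Finset (Fin n))) (f := fun β j => (A (EuclideanSpace.single β 1) i *
      A (EuclideanSpace.single β 1) j) • B (EuclideanSpace.single i 1) (EuclideanSpace.single j 1)),
    ← Finset.sum_smul, hcoef, ite_smul, zero_smul, Finset.sum_ite_eq, Finset.mem_univ, if_true,
    Finset.smul_sum]

lemma divF_smul_comp_affine {F : Type*} [NormedAddCommGroup F] [NormedSpace ℝ F]
    {T : Euc n → Euc n →L[ℝ] F} (hT : Differentiable ℝ T) (u₀ : Euc n)
    (A : Euc a →L[ℝ] Euc n) (c k : ℝ)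
    (hA : A ∘L adjoint A = c • ContinuousLinearMap.id ℝ (Euc n)) (x : Euc a) :
    divF (fun y => k • (T (u₀ + A y) ∘L A)) x = (k * c) • divF T (u₀ + A x) := by
  have h1 : ∀ (w : Euc n) (z : Euc n), fderiv ℝ (fun y => T y w) z = (fderiv ℝ T z).flip w := by
    intro w z
    exact ((hT z).hasFDerivAt.clm_apply (hasFDerivAt_const w z)).fderiv.trans (by ext; simp)
  have h2 : ∀ w : Euc a, fderiv ℝ (fun y => (k • (T (u₀ + A y) ∘L A)) w) x w =
      k • fderiv ℝ T (u₀ + A x) (A w) (A w) := by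
    intro w
    have hu : HasFDerivAt (fun y => u₀ + A y) A x := A.hasFDerivAt.const_add u₀
    have := ((((hT (u₀ + A x)).hasFDerivAt.comp x hu).clm_apply
      (hasFDerivAt_const (A w) x)).const_smul k)
    have h := this.fderiv
    simp only [Function.comp_apply] at h
    simp only [smul_apply, comp_apply]
    erw [h]
    simp
  simp only [divF, h2, h1, flip_apply]
  rw [← Finset.smul_sum, sum_bilin_comp_of_comp_adjoint_eq_smul A c hA, smul_smul]

lemma wmStress_comp_affine {f : Euc n → Euc ℓ} (hf : Differentiable ℝ f) (p : ℝ) {m : ℕ}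
    (hm : m ≠ 0) (u₀ : Euc n) (A : Euc a →L[ℝ] Euc n) {c : ℝ} (hc : 0 ≤ c)
    (hA : A ∘L adjoint A = c • ContinuousLinearMap.id ℝ (Euc n)) (x : Euc a) :
    wmStress p m (fun y => f (u₀ + A y)) x =
      (Real.sqrt (c ^ m) ^ (p - 2) * c ^ (m - 1)) • (wmStress p m f (u₀ + A x) ∘L A) := by
  have hD : fderiv ℝ (fun y => f (u₀ + A y)) x = fderiv ℝ f (u₀ + A x) ∘L A :=
    ((hf (u₀ + A x)).hasFDerivAt.comp x (A.hasFDerivAt.const_add u₀)).fderiv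
  have hAD : ∀ D : Euc n →L[ℝ] Euc ℓ,
      (D ∘L A) ∘L adjoint (D ∘L A) = c • (D ∘L adjoint D) := fun D => by
    rw [adjoint_comp, comp_assoc, ← comp_assoc A, hA]
    simp
  have hN : dmNormSq m (fun y => f (u₀ + A y)) x = c ^ m * dmNormSq m f (u₀ + A x) := by
    rw [dmNormSq, dmNormSq, hD, trace_comp_comm_pow _ _ m hm, hAD, smul_pow,
      trace_comp_comm_pow _ _ m hm]
    simp
  have hσ : mstress m (fun y => f (u₀ + A y)) x = c ^ (m - 1) • (mstress m f (u₀ + A x) ∘L A) := by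
    rw [mstress, mstress, hD, hAD, smul_pow, smul_comp, comp_assoc]
  rw [wmStress, wmStress, hN, hσ, Real.sqrt_mul (by positivity),
    Real.mul_rpow (Real.sqrt_nonneg _) (Real.sqrt_nonneg _), smul_comp, smul_smul, smul_smul]
  congr 1
  ring

end Symphonic

/-- for `p ≥ 2`, `m ≥ 2`, and `u(x) = u₀ + A x` affine with `A ∘ A* = λ² id`,
if `f : ℝ^n → ℝ^ℓ` is (smooth and) `p`-`m`-symphonic then so is `f ∘ u`. -/
theorem stmt12 {a n ℓ : ℕ} (p : ℝ) (hp : 2 ≤ p) (m : ℕ) (hm : 2 ≤ m)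
    (u₀ : Euc n) (A : Euc a →L[ℝ] Euc n) (lam : ℝ) (hlam : 0 ≤ lam)
    (hA : A ∘L (ContinuousLinearMap.adjoint A)
      = (lam ^ 2) • ContinuousLinearMap.id ℝ (Euc n))
    (u : Euc a → Euc n) (hu : ∀ x, u x = u₀ + A x)
    (f : Euc n → Euc ℓ) (hf : ContDiff ℝ (⊤ : ℕ∞) f)
    (hsym : IsPMSymphonic p m f) :
    IsPMSymphonic p m (f ∘ u) := by
  have hu' : f ∘ u = fun y => f (u₀ + A y) := funext fun y => congrArg f (hu y)
  have hfd : Differentiable ℝ f := hf.differentiable (by simp)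
  have hT : wmStress p m (f ∘ u) = fun y => (Real.sqrt ((lam ^ 2) ^ m) ^ (p - 2) *
      (lam ^ 2) ^ (m - 1)) • (wmStress p m f (u₀ + A y) ∘L A) := by
    rw [hu']
    exact funext fun y => wmStress_comp_affine hfd p (by omega) u₀ A (sq_nonneg lam) hA y
  intro x
  rw [hT, divF_smul_comp_affine (differentiable_wmStress hf hp m) u₀ A _ _ hA, hsym, smul_zero]
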